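/- arXiv:1007.3401 — 2 statements merged into one kernel-verified Lean document; each statement's English description precedes it below -/
import Mathlib

section
/- Let β > 0, T > 0, and let X = (X_n)_{n≥1} be a weak solution of the inviscid dyadic model on [0,T] with X_n(t) ≥ 0 for all n and t, such that sup_{t∈[0,T], n≥1} (λ_n^{β-1} X_n(t)) < ∞. Then X is the unique solution with initial condition (X_n(0))_{n≥1} in the class of Leray–Hopf solutions: any Leray–Hopf solution on [0,T] with the same initial condition coincides with X. -/
/-- The dyadic frequencies: `λ_0 = 0`, `λ_n = 2^n` for `n ≥ 1`. -/
noncomputable def lam (n : ℕ) : ℝ := if n = 0 then 0 else 2 ^ n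

/-- `X` is a weak solution of the inviscid dyadic model with parameter `β` on `I`. -/
def IsInviscidSolution (β : ℝ) (I : Set ℝ) (X : ℕ → ℝ → ℝ) : Prop :=
  ∀ n, 1 ≤ n → ∀ t ∈ I, HasDerivWithinAt (X n)
    (lam (n - 1) ^ β * (X (n - 1) t) ^ 2 - lam n ^ β * X n t * X (n + 1) t) I t

/-- `X` is a Leray–Hopf solution of the inviscid model on `I`: it takes values in
`H = {x : Σ_{n≥1} x_n² < ∞}` and the energy `‖X(t)‖_H` is nonincreasing. -/
def IsInviscidLerayHopf (β : ℝ) (I : Set ℝ) (X : ℕ → ℝ → ℝ) : Prop :=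
  IsInviscidSolution β I X ∧
  (∀ t ∈ I, Summable fun n => X (n + 1) t ^ 2) ∧
  (∀ s ∈ I, ∀ t ∈ I, s ≤ t → (∑' n, X (n + 1) t ^ 2) ≤ ∑' n, X (n + 1) s ^ 2)

open Set Finset

/-- A function on `[0, T]` whose derivative is at most `M` grows at most like `M t`. -/
theorem le_add_mul_of_hasDerivWithinAt_le {T M : ℝ} {f f' : ℝ → ℝ}
    (hf : ∀ t ∈ Icc 0 T, HasDerivWithinAt f (f' t) (Icc 0 T) t)
    (hM : ∀ t ∈ Icc 0 T, f' t ≤ M) {t : ℝ} (ht : t ∈ Icc 0 T) : f t ≤ f 0 + M * t := by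
  refine image_le_of_deriv_right_le_deriv_boundary (f' := f') (B := fun s => f 0 + M * s)
    (B' := fun _ => M) (fun s hs => (hf s hs).continuousWithinAt) ?_ (by simp) (by fun_prop) ?_
    (fun s hs => hM s (Ico_subset_Icc_self hs)) ht
  · exact fun s hs => (hf s (Ico_subset_Icc_self hs)).mono_of_mem_nhdsWithin
      (Icc_mem_nhdsGE_of_mem hs)
  · intro s _
    simpa using (((hasDerivAt_id s).const_mul M).const_add (f 0)).hasDerivWithinAt

/-- A solution of `f' = g - a f` with `g ≥ 0`, `a` continuous and `f 0 ≥ 0` stays nonnegative. -/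
theorem nonneg_of_hasDerivWithinAt_sub_mul {T : ℝ} {f g a : ℝ → ℝ}
    (hf : ∀ t ∈ Icc 0 T, HasDerivWithinAt f (g t - a t * f t) (Icc 0 T) t)
    (hg : ∀ t ∈ Icc 0 T, 0 ≤ g t) (ha : ContinuousOn a (Icc 0 T)) (h0 : 0 ≤ f 0)
    {t : ℝ} (ht : t ∈ Icc 0 T) : 0 ≤ f t := by
  obtain ⟨K, hK⟩ := isCompact_Icc.exists_bound_of_continuousOn ha
  have key : ∀ ε > 0, -f t ≤ ε * Real.exp ((K + 1) * t) := by
    intro ε hε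
    refine image_le_of_deriv_right_lt_deriv_boundary (f := fun s => -f s)
      (f' := fun s => -(g s - a s * f s)) (B := fun s => ε * Real.exp ((K + 1) * s))
      (B' := fun s => ε * (Real.exp ((K + 1) * s) * (K + 1)))
      (fun s hs => (hf s hs).continuousWithinAt.neg) ?_ (by simp; linarith) ?_ ?_ ht
    · exact fun s hs => (hf s (Ico_subset_Icc_self hs)).neg.mono_of_mem_nhdsWithin
        (Icc_mem_nhdsGE_of_mem hs)
    · intro s
      simpa using (((hasDerivAt_id s).const_mul (K + 1)).exp.const_mul ε)
    · intro s hs hsB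
      have hs' := Ico_subset_Icc_self hs
      have hB : 0 < ε * Real.exp ((K + 1) * s) := by positivity
      have hKs := neg_le_of_abs_le (hK s hs')
      have hgs := hg s hs'
      have hfs : f s = -(ε * Real.exp ((K + 1) * s)) := by linarith
      rw [hfs]
      nlinarith
  by_contra! hneg
  have hE := Real.exp_pos ((K + 1) * t)
  have := key (-f t / (2 * Real.exp ((K + 1) * t))) (div_pos (by linarith) (by positivity))
  rw [div_mul_eq_mul_div, le_div_iff₀ (by positivity)] at this
  nlinarith

/-- The right-hand side of the dyadic model, indexed from `0`, with coefficients `c`. -/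
def dyadicRHS (c x : ℕ → ℝ) : ℕ → ℝ
  | 0 => -(c 0 * x 0 * x 1)
  | k + 1 => c k * x k ^ 2 - c (k + 1) * x (k + 1) * x (k + 2)

theorem sum_mul_dyadicRHS (c x : ℕ → ℝ) (N : ℕ) :
    ∑ k ∈ range (N + 1), 2 * x k * dyadicRHS c x k = -(2 * c N * x N ^ 2 * x (N + 1)) := by
  induction N with
  | zero => simp [dyadicRHS]; ring
  | succ N ih => rw [sum_range_succ, ih, dyadicRHS]; ring

theorem sum_weighted_sub_mul_dyadicRHS_sub_le {c x y : ℕ → ℝ} (hc : ∀ k, 0 ≤ c k)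
    (hx : ∀ k, 0 ≤ x k) (hy : ∀ k, 0 ≤ y k) (N : ℕ) :
    ∑ k ∈ range (N + 1),
        (1 / 2) ^ k * (2 * (x k - y k) * (dyadicRHS c x k - dyadicRHS c y k)) ≤
      -((1 / 2) ^ N * c N * ((x N ^ 2 - y N ^ 2) * (x (N + 1) - y (N + 1)))) := by
  induction N with
  | zero =>
    have h := mul_nonneg (hc 0) (mul_nonneg (sq_nonneg (x 0 - y 0)) (add_nonneg (hx 1) (hy 1)))
    simp only [dyadicRHS, zero_add, range_one, sum_singleton, pow_zero]
    linarith
  | succ N ih =>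
    have h := mul_nonneg (mul_nonneg (pow_nonneg one_half_pos.le (N + 1) : (0 : ℝ) ≤ _)
      (hc (N + 1))) (mul_nonneg (sq_nonneg (x (N + 1) - y (N + 1)))
      (add_nonneg (hx (N + 2)) (hy (N + 2))))
    rw [sum_range_succ]
    refine (add_le_add_left ih _).trans ?_
    simp only [dyadicRHS]
    rw [pow_succ _ N] at h ⊢
    linarith

/-- Nonnegative solutions of the dyadic model do not gain energy. -/
theorem sum_sq_le_of_dyadic {T : ℝ} {c : ℕ → ℝ} {x : ℕ → ℝ → ℝ} (hc : ∀ k, 0 ≤ c k)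
    (hx : ∀ k, ∀ t ∈ Icc 0 T,
      HasDerivWithinAt (x k) (dyadicRHS c (fun j => x j t) k) (Icc 0 T) t)
    (hx0 : ∀ k, ∀ t ∈ Icc 0 T, 0 ≤ x k t) (N : ℕ) {t : ℝ} (ht : t ∈ Icc 0 T) :
    ∑ k ∈ range (N + 1), x k t ^ 2 ≤ ∑ k ∈ range (N + 1), x k 0 ^ 2 := by
  have := le_add_mul_of_hasDerivWithinAt_le (M := 0)
    (f := fun s => ∑ k ∈ range (N + 1), x k s ^ 2)
    (f' := fun s => ∑ k ∈ range (N + 1), 2 * x k s * dyadicRHS c (fun j => x j s) k)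
    (fun s hs => HasDerivWithinAt.fun_sum fun k _ => by simpa using (hx k s hs).fun_pow 2) ?_ ht
  · simpa using this
  · intro s hs
    rw [sum_mul_dyadicRHS c (fun j => x j s)]
    have := hc N
    have := hx0 N s hs
    have := hx0 (N + 1) s hs
    exact neg_nonpos.2 (by positivity)

/-- Two nonnegative finite-energy solutions of the dyadic model with the same initial condition
coincide if one of them satisfies `2⁻ᵏ c_k x_k ≤ C` and `2⁻ᵏ c_k x_{k+1} ≤ C`. -/
theorem eq_of_dyadic {T C : ℝ} {c : ℕ → ℝ} {x y : ℕ → ℝ → ℝ} (hc : ∀ k, 0 ≤ c k)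
    (hx : ∀ k, ∀ t ∈ Icc 0 T,
      HasDerivWithinAt (x k) (dyadicRHS c (fun j => x j t) k) (Icc 0 T) t)
    (hy : ∀ k, ∀ t ∈ Icc 0 T,
      HasDerivWithinAt (y k) (dyadicRHS c (fun j => y j t) k) (Icc 0 T) t)
    (hx0 : ∀ k, ∀ t ∈ Icc 0 T, 0 ≤ x k t) (hy0 : ∀ k, ∀ t ∈ Icc 0 T, 0 ≤ y k t)
    (hinit : ∀ k, y k 0 = x k 0) (hsum : Summable fun k => y k 0 ^ 2)
    (hC : ∀ k, ∀ t ∈ Icc 0 T, (1 / 2) ^ k * c k * x k t ≤ C)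
    (hC' : ∀ k, ∀ t ∈ Icc 0 T, (1 / 2) ^ k * c k * x (k + 1) t ≤ C)
    (k : ℕ) {t : ℝ} (ht : t ∈ Icc 0 T) : y k t = x k t := by
  have hC0 : 0 ≤ C := (mul_nonneg (mul_nonneg (by positivity) (hc 0)) (hx0 0 t ht)).trans
    (hC 0 t ht)
  set E := ∑' k, y k 0 ^ 2
  have hEx (M : ℕ) {s : ℝ} (hs : s ∈ Icc 0 T) : ∑ k ∈ range (M + 1), x k s ^ 2 ≤ E := by
    refine (sum_sq_le_of_dyadic hc hx hx0 M hs).trans ?_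
    simpa only [← hinit] using hsum.sum_le_tsum (range (M + 1)) fun _ _ => sq_nonneg _
  have hEy (M : ℕ) {s : ℝ} (hs : s ∈ Icc 0 T) : ∑ k ∈ range (M + 1), y k s ^ 2 ≤ E :=
    (sum_sq_le_of_dyadic hc hy hy0 M hs).trans
      (hsum.sum_le_tsum (range (M + 1)) fun _ _ => sq_nonneg _)
  have boundary (N : ℕ) {s : ℝ} (hs : s ∈ Icc 0 T) :
      -((1 / 2) ^ N * c N * ((x N s ^ 2 - y N s ^ 2) * (x (N + 1) s - y (N + 1) s))) ≤
        C * (x N s ^ 2 + y (N + 1) s ^ 2 + y N s ^ 2) := by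
    have hw : 0 ≤ (1 / 2) ^ N * c N := mul_nonneg (by positivity) (hc N)
    have h1 := hx0 N s hs
    have h2 := hx0 (N + 1) s hs
    have h3 := hy0 N s hs
    have h4 := hy0 (N + 1) s hs
    have e1 := mul_le_mul_of_nonneg_right (hC N s hs) (mul_nonneg h1 h4)
    have e2 := mul_le_mul_of_nonneg_right (hC' N s hs) (sq_nonneg (y N s))
    have e3 := mul_nonneg hw (mul_nonneg (sq_nonneg (x N s)) h2)
    have e4 := mul_nonneg hw (mul_nonneg (sq_nonneg (y N s)) h4)
    have e5 : C * (x N s * y (N + 1) s) ≤ C * (x N s ^ 2 + y (N + 1) s ^ 2) :=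
      mul_le_mul_of_nonneg_left (by nlinarith [sq_nonneg (x N s - y (N + 1) s)]) hC0
    linarith
  have growth (M : ℕ) : ∑ N ∈ range M, ∑ j ∈ range (N + 1), (1 / 2) ^ j * (x j t - y j t) ^ 2 ≤
      3 * C * E * t := by
    have := le_add_mul_of_hasDerivWithinAt_le (M := 3 * C * E)
      (f := fun s => ∑ N ∈ range M, ∑ j ∈ range (N + 1), (1 / 2) ^ j * (x j s - y j s) ^ 2)
      (f' := fun s => ∑ N ∈ range M, ∑ j ∈ range (N + 1), (1 / 2) ^ j *
        (2 * (x j s - y j s) * (dyadicRHS c (fun i => x i s) j - dyadicRHS c (fun i => y i s) j)))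
      (fun s hs => HasDerivWithinAt.fun_sum fun N _ => HasDerivWithinAt.fun_sum fun j _ => by
        simpa using (((hx j s hs).fun_sub (hy j s hs)).fun_pow 2).const_mul ((1 / 2 : ℝ) ^ j)) ?_ ht
    · simpa [hinit] using this
    · intro s hs
      calc _ ≤ ∑ N ∈ range M, C * (x N s ^ 2 + y (N + 1) s ^ 2 + y N s ^ 2) :=
            sum_le_sum fun N _ => (sum_weighted_sub_mul_dyadicRHS_sub_le hc
              (fun j => hx0 j s hs) (fun j => hy0 j s hs) N).trans (boundary N hs)
        _ = C * (∑ N ∈ range M, x N s ^ 2 + ∑ N ∈ range M, y (N + 1) s ^ 2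
              + ∑ N ∈ range M, y N s ^ 2) := by
            rw [← mul_sum, sum_add_distrib, sum_add_distrib]
        _ ≤ C * (E + E + E) := by
            have h1 := hEx M hs
            have h2 := hEy M hs
            have h3 := h2
            rw [sum_range_succ] at h1 h3
            rw [sum_range_succ'] at h2
            have := sq_nonneg (x M s)
            have := sq_nonneg (y M s)
            have := sq_nonneg (y 0 s)
            exact mul_le_mul_of_nonneg_left (by linarith) hC0
        _ = 3 * C * E := by ring
  by_contra hne
  have hd : 0 < (1 / 2) ^ k * (x k t - y k t) ^ 2 := by
    have : x k t - y k t ≠ 0 := sub_ne_zero.2 (Ne.symm hne)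
    positivity
  obtain ⟨m, hm⟩ := exists_nat_gt (3 * C * E * t / ((1 / 2) ^ k * (x k t - y k t) ^ 2))
  rw [div_lt_iff₀ hd] at hm
  have hpos (N : ℕ) : 0 ≤ ∑ j ∈ range (N + 1), (1 / 2) ^ j * (x j t - y j t) ^ 2 :=
    sum_nonneg fun j _ => by positivity
  have hle : (m : ℝ) * ((1 / 2) ^ k * (x k t - y k t) ^ 2) ≤
      ∑ N ∈ range (k + m), ∑ j ∈ range (N + 1), (1 / 2) ^ j * (x j t - y j t) ^ 2 := by
    rw [sum_range_add, ← nsmul_eq_mul]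
    refine le_add_of_nonneg_of_le (sum_nonneg fun N _ => hpos N) ?_
    simpa using card_nsmul_le_sum (range m) (fun i => ∑ j ∈ range (k + i + 1),
      (1 / 2 : ℝ) ^ j * (x j t - y j t) ^ 2) _ fun i _ =>
        single_le_sum (f := fun j => (1 / 2 : ℝ) ^ j * (x j t - y j t) ^ 2)
          (fun j _ => by positivity) (mem_range.2 (by omega : k < k + i + 1))
  exact (hm.trans_le (hle.trans (growth _))).false

theorem IsInviscidSolution.hasDerivWithinAt_dyadicRHS {β : ℝ} (hβ : 0 < β) {I : Set ℝ}
    {X : ℕ → ℝ → ℝ} (hX : IsInviscidSolution β I X) (k : ℕ) {t : ℝ} (ht : t ∈ I) :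
    HasDerivWithinAt (X (k + 1))
      (dyadicRHS (fun j => lam (j + 1) ^ β) (fun j => X (j + 1) t) k) I t := by
  have h := hX (k + 1) (by omega) t ht
  cases k with
  | zero => simpa [dyadicRHS, lam, Real.zero_rpow hβ.ne'] using h
  | succ k => simpa [dyadicRHS] using h

/-- Solutions of the dyadic model preserve nonnegativity of the initial condition. -/
theorem IsInviscidSolution.nonneg {β T : ℝ} {X : ℕ → ℝ → ℝ}
    (hX : IsInviscidSolution β (Icc 0 T) X) (h0 : ∀ n, 1 ≤ n → 0 ≤ X n 0) {n : ℕ} (hn : 1 ≤ n)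
    {t : ℝ} (ht : t ∈ Icc 0 T) : 0 ≤ X n t := by
  have hlam (m : ℕ) : 0 ≤ lam m := by unfold lam; split_ifs <;> positivity
  refine nonneg_of_hasDerivWithinAt_sub_mul (g := fun s => lam (n - 1) ^ β * X (n - 1) s ^ 2)
    (a := fun s => lam n ^ β * X (n + 1) s) (fun s hs => ?_) (fun s _ => ?_) ?_ (h0 n hn) ht
  · exact (hX n hn s hs).congr_deriv (by ring)
  · exact mul_nonneg (Real.rpow_nonneg (hlam _) _) (sq_nonneg _)
  · exact continuousOn_const.mul fun s hs =>
      (hX (n + 1) (by omega) s hs).continuousWithinAt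

theorem half_pow_mul_lam_rpow (β : ℝ) (k : ℕ) :
    (1 / 2) ^ k * lam (k + 1) ^ β = 2 * lam (k + 1) ^ (β - 1) := by
  have h : (0 : ℝ) < 2 ^ (k + 1) := by positivity
  simp only [lam, Nat.succ_ne_zero, if_false]
  rw [Real.rpow_sub_one h.ne', one_div, inv_pow, pow_succ]
  field_simp

theorem half_pow_mul_lam_rpow' (β : ℝ) (k : ℕ) :
    (1 / 2) ^ k * lam (k + 1) ^ β = 2 * 2 ^ (1 - β) * lam (k + 2) ^ (β - 1) := by
  have h : (0 : ℝ) ≤ 2 ^ (k + 1) := by positivity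
  rw [half_pow_mul_lam_rpow]
  simp only [lam, Nat.succ_ne_zero, if_false]
  rw [pow_succ 2 (k + 1), Real.mul_rpow h zero_le_two, ← neg_sub β 1,
    Real.rpow_neg zero_le_two]
  field_simp

/-- a positive weak solution of the inviscid dyadic model with
`sup_{t,n} λ_n^{β-1} X_n(t) < ∞` is unique in the class of Leray–Hopf solutions. -/
theorem inviscid_uniqueness_LerayHopf
    (β T : ℝ) (hβ : 0 < β) (hT : 0 < T)
    (X : ℕ → ℝ → ℝ) (hX : IsInviscidSolution β (Set.Icc 0 T) X)
    (hpos : ∀ n, 1 ≤ n → ∀ t ∈ Set.Icc (0 : ℝ) T, 0 ≤ X n t)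
    (hbd : ∃ C : ℝ, ∀ t ∈ Set.Icc (0 : ℝ) T, ∀ n, 1 ≤ n →
      lam n ^ (β - 1) * X n t ≤ C) :
    ∀ Y : ℕ → ℝ → ℝ, IsInviscidLerayHopf β (Set.Icc 0 T) Y →
      (∀ n, 1 ≤ n → Y n 0 = X n 0) →
      ∀ n, 1 ≤ n → ∀ t ∈ Set.Icc (0 : ℝ) T, Y n t = X n t := by
  intro Y hY hinit n hn t ht
  obtain ⟨C, hC⟩ := hbd
  obtain ⟨hYsol, hYsum, -⟩ := hY
  have h0 : (0 : ℝ) ∈ Icc 0 T := ⟨le_rfl, hT.le⟩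
  have hY0 (k : ℕ) (s : ℝ) (hs : s ∈ Icc 0 T) : 0 ≤ Y (k + 1) s :=
    hYsol.nonneg (fun m hm => (hinit m hm).symm ▸ hpos m hm 0 h0) (by omega) hs
  obtain ⟨k, rfl⟩ := Nat.exists_eq_add_of_le' hn
  refine eq_of_dyadic (c := fun j => lam (j + 1) ^ β) (x := fun j => X (j + 1))
    (y := fun j => Y (j + 1)) (C := max (2 * C) (2 * 2 ^ (1 - β) * C))
    (fun j => ?_) (fun j s hs => hX.hasDerivWithinAt_dyadicRHS hβ j hs)
    (fun j s hs => hYsol.hasDerivWithinAt_dyadicRHS hβ j hs)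
    (fun j s hs => hpos _ (by omega) s hs) hY0 (fun j => hinit _ (by omega)) (hYsum 0 h0)
    (fun j s hs => ?_) (fun j s hs => ?_) k ht
  · unfold lam
    split_ifs <;> positivity
  · rw [half_pow_mul_lam_rpow, mul_assoc]
    exact (mul_le_mul_of_nonneg_left (hC s hs _ (by omega)) zero_le_two).trans (le_max_left _ _)
  · rw [half_pow_mul_lam_rpow', mul_assoc]
    exact (mul_le_mul_of_nonneg_left (hC s hs _ (by omega)) (by positivity)).trans
      (le_max_right _ _)
end

section
/- Let β = 5/2. There exists γ₀ > 1/2 such that for every γ ∈ (1/2, γ₀) and every initial condition x = (x_n)_{n≥1} with x_n ≥ 0 for all n ≥ 1 and sup_{n≥1} (λ_n^γ x_n) < ∞, the following holds. For ν > 0 let X^{[ν]} be the unique weak solution of the viscous dyadic model with viscosity ν and initial condition x, and let X be the unique global weak solution of the inviscid dyadic model with initial condition x satisfying sup_{t≥0} sup_{n≥1} (λ_n^γ X_n(t)) < ∞. Then for every n ≥ 1, X_n^{[ν]} → X_n as ν → 0, uniformly in time on compact subsets of [0,∞). -/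
/-- `X` is a weak solution of the viscous dyadic model with parameter `β` and
viscosity `ν` on the interval `I`. -/
def IsViscousSolution (β ν : ℝ) (I : Set ℝ) (X : ℕ → ℝ → ℝ) : Prop :=
  ∀ n, 1 ≤ n → ∀ t ∈ I, HasDerivWithinAt (X n)
    (-ν * lam n ^ 2 * X n t + lam (n - 1) ^ β * (X (n - 1) t) ^ 2
      - lam n ^ β * X n t * X (n + 1) t) I t

open Set Filter Topology

/-- For `n ≥ 1`, `dyadicBase ^ n` is the value of `λ_n ^ (5/2)`. -/
noncomputable def dyadicBase : ℝ := 2 ^ (5 / 2 : ℝ)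

theorem dyadicBase_sq : dyadicBase ^ 2 = 32 := by
  unfold dyadicBase
  rw [← Real.rpow_natCast, ← Real.rpow_mul (by norm_num)]
  norm_num

theorem dyadicBase_pos : 0 < dyadicBase := by
  unfold dyadicBase
  positivity

theorem five_lt_dyadicBase : 5 < dyadicBase := by
  nlinarith [dyadicBase_sq, dyadicBase_pos]

theorem dyadicBase_lt_six : dyadicBase < 6 := by
  nlinarith [dyadicBase_sq, dyadicBase_pos]

theorem lam_succ_rpow (n : ℕ) : lam (n + 1) ^ (5 / 2 : ℝ) = dyadicBase ^ (n + 1) := by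
  unfold lam dyadicBase
  rw [if_neg (Nat.succ_ne_zero n), ← Real.rpow_natCast, ← Real.rpow_natCast,
    ← Real.rpow_mul (by norm_num), ← Real.rpow_mul (by norm_num), mul_comm]

/-- The right-hand side of the dyadic model with `β = 5/2`, for sequences vanishing at `0`. -/
noncomputable def dyadicField (ν : ℝ) (y : ℕ → ℝ) : ℕ → ℝ
  | 0 => 0
  | n + 1 => -ν * 4 ^ (n + 1) * y (n + 1) + dyadicBase ^ n * y n ^ 2
      - dyadicBase ^ (n + 1) * y (n + 1) * y (n + 2)

/-- A nonnegative solution of the dyadic model with `β = 5/2` on `(0, ∞)`, extended to a continuous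
function on the whole line, with a vanishing component of index `0`. -/
structure IsDyadicFlow (ν : ℝ) (Y : ℕ → ℝ → ℝ) : Prop where
  continuous : ∀ n, Continuous (Y n)
  zero : ∀ t, Y 0 t = 0
  nonneg : ∀ n t, 0 ≤ Y n t
  hasDerivAt : ∀ n t, 0 < t → HasDerivAt (Y n) (dyadicField ν (fun m => Y m t) n) t

theorem sub_le_integral_of_hasDerivAt_le {f f' g : ℝ → ℝ} {T : ℝ} (hT : 0 ≤ T)
    (hf : Continuous f) (hg : Continuous g) (hder : ∀ t, 0 < t → HasDerivAt f (f' t) t)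
    (hle : ∀ t, 0 < t → f' t ≤ g t) : f T - f 0 ≤ ∫ t in (0 : ℝ)..T, g t :=
  intervalIntegral.sub_le_integral_of_hasDeriv_right_of_le hT hf.continuousOn
    (fun t ht => (hder t ht.1).hasDerivWithinAt) hg.continuousOn.integrableOn_Icc
    (fun t ht => hle t ht.1)

theorem integral_nonneg_of_nonneg {f : ℝ → ℝ} {T : ℝ} (hT : 0 ≤ T) (hf : ∀ t, 0 ≤ f t) :
    0 ≤ ∫ t in (0 : ℝ)..T, f t :=
  intervalIntegral.integral_nonneg hT fun t _ => hf t

theorem sum_energy_field (ν : ℝ) (y : ℕ → ℝ) (h0 : y 0 = 0) (N : ℕ) :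
    ∑ n ∈ Finset.range (N + 1), 2 * y n * dyadicField ν y n =
      -(∑ n ∈ Finset.range (N + 1), 2 * ν * 4 ^ n * y n ^ 2)
        - 2 * dyadicBase ^ N * y N ^ 2 * y (N + 1) := by
  induction N with
  | zero => simp [h0]
  | succ N ih =>
    rw [Finset.sum_range_succ, ih, Finset.sum_range_succ _ (N + 1)]
    simp only [dyadicField]
    ring

theorem sum_difference_field (ν : ℝ) (y x : ℕ → ℝ) (hy : y 0 = 0) (hx : x 0 = 0) (N : ℕ) :
    ∑ n ∈ Finset.range (N + 1),
        (1 / 2) ^ n * (2 * (y n - x n) * (dyadicField ν y n - dyadicField 0 x n)) =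
      -(∑ n ∈ Finset.range (N + 1), (2 * ν * 2 ^ n * y n * (y n - x n)
          + (dyadicBase / 2) ^ n * (y n - x n) ^ 2 * (y (n + 1) + x (n + 1))))
        - (dyadicBase / 2) ^ N * (y N + x N) * (y N - x N) * (y (N + 1) - x (N + 1)) := by
  induction N with
  | zero => simp [hx, hy]
  | succ N ih =>
    rw [Finset.sum_range_succ, ih, Finset.sum_range_succ _ (N + 1)]
    simp only [dyadicField]
    have h4 : (4 : ℝ) ^ (N + 1) = 2 ^ (N + 1) * 2 ^ (N + 1) := by
      rw [← mul_pow]; norm_num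
    have h1 : (1 / 2 : ℝ) ^ (N + 1) * 2 ^ (N + 1) = 1 := by
      rw [← mul_pow]; norm_num
    have h2 : (dyadicBase / 2) ^ N = 2 * ((1 / 2) ^ (N + 1) * dyadicBase ^ N) := by
      rw [div_eq_mul_one_div, mul_pow, pow_succ]; ring
    have h3 : (dyadicBase / 2) ^ (N + 1) = (1 / 2) ^ (N + 1) * dyadicBase ^ (N + 1) := by
      rw [div_eq_mul_one_div, mul_pow]; ring
    rw [h2, h3, h4]
    linear_combination (-2 * ν * 2 ^ (N + 1) * y (N + 1) * (y (N + 1) - x (N + 1))) * h1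

namespace IsDyadicFlow

variable {ν : ℝ} {Y : ℕ → ℝ → ℝ}

theorem energy_le (h : IsDyadicFlow ν Y) (hν : 0 ≤ ν) (N : ℕ) {T : ℝ} (hT : 0 ≤ T) :
    ∑ n ∈ Finset.range (N + 1), Y n T ^ 2
      + 2 * (ν * 4 ^ N * ∫ t in (0 : ℝ)..T, Y N t ^ 2)
      + 2 * (dyadicBase ^ N * ∫ t in (0 : ℝ)..T, Y N t ^ 2 * Y (N + 1) t)
      ≤ ∑ n ∈ Finset.range (N + 1), Y n 0 ^ 2 := by
  have hc := h.continuous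
  have key := sub_le_integral_of_hasDerivAt_le (f := fun t => ∑ n ∈ Finset.range (N + 1), Y n t ^ 2)
    (f' := fun t => ∑ n ∈ Finset.range (N + 1), 2 * Y n t * dyadicField ν (fun m => Y m t) n)
    (g := fun t => -(2 * (ν * 4 ^ N)) * Y N t ^ 2
      + -(2 * dyadicBase ^ N) * (Y N t ^ 2 * Y (N + 1) t))
    hT (by fun_prop) (by fun_prop)
    (fun t ht => by
      refine HasDerivAt.fun_sum fun n _ => ?_
      simpa using (h.hasDerivAt n t ht).fun_pow 2)
    (fun t _ => by
      rw [sum_energy_field ν (fun m => Y m t) (h.zero t)]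
      have hs : 2 * ν * 4 ^ N * Y N t ^ 2
          ≤ ∑ n ∈ Finset.range (N + 1), 2 * ν * 4 ^ n * Y n t ^ 2 :=
        Finset.single_le_sum (f := fun n => 2 * ν * 4 ^ n * Y n t ^ 2)
          (fun n _ => by positivity) (Finset.self_mem_range_succ N)
      linarith)
  rw [intervalIntegral.integral_add
    (Continuous.intervalIntegrable (by fun_prop) _ _)
    (Continuous.intervalIntegrable (by fun_prop) _ _),
    intervalIntegral.integral_const_mul, intervalIntegral.integral_const_mul] at key
  linarith

variable {E : ℝ}

theorem sum_sq_le (h : IsDyadicFlow ν Y) (hν : 0 ≤ ν)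
    (hE : ∀ N, ∑ n ∈ Finset.range (N + 1), Y n 0 ^ 2 ≤ E) (N : ℕ) {T : ℝ} (hT : 0 ≤ T) :
    ∑ n ∈ Finset.range (N + 1), Y n T ^ 2 ≤ E := by
  have h1 := h.energy_le hν N hT
  have h2 := integral_nonneg_of_nonneg hT fun t => sq_nonneg (Y N t)
  have h3 := integral_nonneg_of_nonneg hT
    fun t => mul_nonneg (sq_nonneg (Y N t)) (h.nonneg (N + 1) t)
  have hq := dyadicBase_pos
  have h4 : 0 ≤ ν * 4 ^ N * ∫ t in (0 : ℝ)..T, Y N t ^ 2 := by positivity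
  have h5 : 0 ≤ dyadicBase ^ N * ∫ t in (0 : ℝ)..T, Y N t ^ 2 * Y (N + 1) t := by positivity
  linarith [hE N]

theorem sq_le (h : IsDyadicFlow ν Y) (hν : 0 ≤ ν)
    (hE : ∀ N, ∑ n ∈ Finset.range (N + 1), Y n 0 ^ 2 ≤ E) (n : ℕ) {T : ℝ} (hT : 0 ≤ T) :
    Y n T ^ 2 ≤ E :=
  (Finset.single_le_sum (f := fun n => Y n T ^ 2) (fun _ _ => sq_nonneg _)
    (Finset.self_mem_range_succ n)).trans (h.sum_sq_le hν hE n hT)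

theorem dissipation_le (h : IsDyadicFlow ν Y) (hν : 0 ≤ ν)
    (hE : ∀ N, ∑ n ∈ Finset.range (N + 1), Y n 0 ^ 2 ≤ E) (N : ℕ) {T : ℝ} (hT : 0 ≤ T) :
    ν * 4 ^ N * ∫ t in (0 : ℝ)..T, Y N t ^ 2 ≤ E / 2 := by
  have h1 := h.energy_le hν N hT
  have h2 : 0 ≤ ∑ n ∈ Finset.range (N + 1), Y n T ^ 2 := Finset.sum_nonneg fun _ _ => sq_nonneg _
  have h3 := integral_nonneg_of_nonneg hT
    fun t => mul_nonneg (sq_nonneg (Y N t)) (h.nonneg (N + 1) t)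
  have hq := dyadicBase_pos
  have h5 : 0 ≤ dyadicBase ^ N * ∫ t in (0 : ℝ)..T, Y N t ^ 2 * Y (N + 1) t := by positivity
  linarith [hE N]

theorem flux_le (h : IsDyadicFlow ν Y) (hν : 0 ≤ ν)
    (hE : ∀ N, ∑ n ∈ Finset.range (N + 1), Y n 0 ^ 2 ≤ E) (N : ℕ) {T : ℝ} (hT : 0 ≤ T) :
    dyadicBase ^ N * ∫ t in (0 : ℝ)..T, Y N t ^ 2 * Y (N + 1) t ≤ E / 2 := by
  have h1 := h.energy_le hν N hT
  have h2 : 0 ≤ ∑ n ∈ Finset.range (N + 1), Y n T ^ 2 := Finset.sum_nonneg fun _ _ => sq_nonneg _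
  have h3 := integral_nonneg_of_nonneg hT fun t => sq_nonneg (Y N t)
  have h4 : 0 ≤ ν * 4 ^ N * ∫ t in (0 : ℝ)..T, Y N t ^ 2 := by positivity
  linarith [hE N]

/-- Differentiating `Y n * Y (n + 1)` controls the cubic moment of one component by an energy
constant and a small multiple of the cubic moments of the next two. -/
theorem cubic_moment_step (h : IsDyadicFlow ν Y) (hν : 0 ≤ ν)
    (hE : ∀ N, ∑ n ∈ Finset.range (N + 1), Y n 0 ^ 2 ≤ E) (n : ℕ) {T : ℝ} (hT : 0 ≤ T) :
    dyadicBase ^ n * ∫ t in (0 : ℝ)..T, Y n t ^ 3 ≤ 1000 * E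
      + 1 / 144 * (dyadicBase ^ (n + 1) * (∫ t in (0 : ℝ)..T, Y (n + 1) t ^ 3)
        + dyadicBase ^ (n + 2) * ∫ t in (0 : ℝ)..T, Y (n + 2) t ^ 3) := by
  have hc := h.continuous
  have hq := dyadicBase_pos
  have hq5 := five_lt_dyadicBase
  have hq6 := dyadicBase_lt_six
  have hq2 := dyadicBase_sq
  have hE0 : 0 ≤ E := (sq_nonneg _).trans (h.sq_le hν hE 0 le_rfl)
  have I (f : ℝ → ℝ) (hf : Continuous f) : IntervalIntegrable f MeasureTheory.volume 0 T :=
    hf.intervalIntegrable _ _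
  have key := sub_le_integral_of_hasDerivAt_le (f := fun t => -(Y n t * Y (n + 1) t))
    (f' := fun t => -(dyadicField ν (fun m => Y m t) n * Y (n + 1) t
      + Y n t * dyadicField ν (fun m => Y m t) (n + 1)))
    (g := fun t => (((-(199 / 200) * dyadicBase ^ n * Y n t ^ 3
      + 5 / 2 * (ν * 4 ^ n) * Y n t ^ 2)
      + 5 / 8 * (ν * 4 ^ (n + 1)) * Y (n + 1) t ^ 2)
      + (50 * dyadicBase ^ n * (Y n t ^ 2 * Y (n + 1) t)
      + 300 * dyadicBase ^ (n + 1) * (Y (n + 1) t ^ 2 * Y (n + 2) t)))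
      + (1 / 200 * dyadicBase ^ (n + 1) * Y (n + 1) t ^ 3
      + 1 / 200 * dyadicBase ^ (n + 2) * Y (n + 2) t ^ 3))
    hT (by fun_prop) (by fun_prop)
    (fun t ht => ((h.hasDerivAt n t ht).fun_mul (h.hasDerivAt (n + 1) t ht)).fun_neg)
    (fun t _ => by
      have ha := h.nonneg n t
      have hb := h.nonneg (n + 1) t
      have hd := h.nonneg (n + 2) t
      have hfield : -(dyadicField ν (fun m => Y m t) n * Y (n + 1) t)
          ≤ ν * 4 ^ n * Y n t * Y (n + 1) t + dyadicBase ^ n * Y n t * Y (n + 1) t ^ 2 := by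
        cases n with
        | zero => simp [dyadicField, h.zero t]
        | succ m =>
          have : 0 ≤ dyadicBase ^ m * Y m t ^ 2 * Y (m + 1 + 1) t := by positivity
          simp only [dyadicField]
          linarith
      have hsucc : Y n t * dyadicField ν (fun m => Y m t) (n + 1) =
        -(4 * (ν * 4 ^ n * Y n t * Y (n + 1) t)) + dyadicBase ^ n * Y n t ^ 3
          - dyadicBase ^ n * (dyadicBase * (Y n t * Y (n + 1) t * Y (n + 2) t)) := by
        simp only [dyadicField]; ring
      generalize Y n t = a at *
      generalize Y (n + 1) t = b at *
      generalize Y (n + 2) t = c at *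
      have hvisc : ν * 4 ^ n * (a * b) ≤ ν * 4 ^ n * ((a ^ 2 + b ^ 2) / 2) :=
        mul_le_mul_of_nonneg_left (by nlinarith [sq_nonneg (a - b)]) (by positivity)
      have hab : a * b ^ 2 ≤ 50 * (a ^ 2 * b) + 1 / 200 * (5 * b ^ 3) := by
        nlinarith [mul_nonneg hb (sq_nonneg (10 * a - b / 20)), pow_nonneg hb 3,
          mul_nonneg hb (sq_nonneg a)]
      have hab' : a * b ^ 2 ≤ 50 * (a ^ 2 * b) + 1 / 200 * (dyadicBase * b ^ 3) := by
        nlinarith [pow_nonneg hb 3]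
      have hac : a ^ 2 * c ≤ a ^ 3 + 32 * c ^ 3 := by
        rcases le_total a c with hle | hle
        · nlinarith [pow_nonneg ha 3, pow_nonneg hd 3,
            mul_le_mul_of_nonneg_right (pow_le_pow_left₀ ha hle 2) hd]
        · nlinarith [pow_nonneg ha 3, pow_nonneg hd 3,
            mul_le_mul_of_nonneg_left hle (sq_nonneg a)]
      have habc : a * b * c ≤ 300 * (b ^ 2 * c) + 1 / 1200 * (a ^ 2 * c) := by
        nlinarith [mul_nonneg hd (sq_nonneg (600 * b - a))]
      have habc' : dyadicBase * (a * b * c)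
          ≤ 300 * dyadicBase * (b ^ 2 * c) + 1 / 200 * (a ^ 3 + dyadicBase ^ 2 * c ^ 3) := by
        have h1 := mul_le_mul_of_nonneg_left habc hq.le
        have h2 : dyadicBase * (a ^ 2 * c) ≤ 6 * (a ^ 2 * c) :=
          mul_le_mul_of_nonneg_right hq6.le (by positivity)
        rw [hq2]
        linarith
      have h1 := mul_le_mul_of_nonneg_left hab' (pow_pos hq n).le
      have h2 := mul_le_mul_of_nonneg_left habc' (pow_pos hq n).le
      have e1 : dyadicBase ^ (n + 1) = dyadicBase ^ n * dyadicBase := pow_succ _ _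
      have e2 : dyadicBase ^ (n + 2) = dyadicBase ^ n * dyadicBase ^ 2 := pow_add _ _ _
      have e3 : (4 : ℝ) ^ (n + 1) = 4 ^ n * 4 := pow_succ _ _
      rw [hsucc, e1, e2, e3]
      linarith)
  rw [intervalIntegral.integral_add (I _ (by fun_prop)) (I _ (by fun_prop)),
    intervalIntegral.integral_add (I _ (by fun_prop)) (I _ (by fun_prop)),
    intervalIntegral.integral_add (I _ (by fun_prop)) (I _ (by fun_prop)),
    intervalIntegral.integral_add (I _ (by fun_prop)) (I _ (by fun_prop)),
    intervalIntegral.integral_add (I _ (by fun_prop)) (I _ (by fun_prop)),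
    intervalIntegral.integral_add (I _ (by fun_prop)) (I _ (by fun_prop))] at key
  simp only [intervalIntegral.integral_const_mul] at key
  have hd1 := h.dissipation_le hν hE n hT
  have hd2 := h.dissipation_le hν hE (n + 1) hT
  have hf1 := h.flux_le hν hE n hT
  have hf2 := h.flux_le hν hE (n + 1) hT
  have hend : Y n T * Y (n + 1) T ≤ E := by
    nlinarith [h.sq_le hν hE n hT, h.sq_le hν hE (n + 1) hT, sq_nonneg (Y n T - Y (n + 1) T)]
  have hstart : 0 ≤ Y n 0 * Y (n + 1) 0 := mul_nonneg (h.nonneg _ _) (h.nonneg _ _)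
  have hp (m : ℕ) : 0 ≤ dyadicBase ^ m * ∫ t in (0 : ℝ)..T, Y m t ^ 3 :=
    mul_nonneg (pow_pos hq m).le (integral_nonneg_of_nonneg hT fun t => pow_nonneg (h.nonneg m t) 3)
  have hp1 := hp (n + 1)
  have hp2 := hp (n + 2)
  simp only [mul_assoc, add_assoc, Nat.reduceAdd] at *
  linarith

/-- Onsager-type bound: the cubic moments of the components are bounded by the initial energy. -/
theorem cubic_moment_le (h : IsDyadicFlow ν Y) (hν : 0 ≤ ν)
    (hE : ∀ N, ∑ n ∈ Finset.range (N + 1), Y n 0 ^ 2 ≤ E) (n : ℕ) {T : ℝ} (hT : 0 ≤ T) :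
    dyadicBase ^ n * ∫ t in (0 : ℝ)..T, Y n t ^ 3 ≤ 2000 * E := by
  have hq := dyadicBase_pos
  have hE0 : 0 ≤ E := (sq_nonneg _).trans (h.sq_le hν hE 0 le_rfl)
  set K : ℝ := E * (E + 1) * T with hK
  have hK0 : 0 ≤ K := by positivity
  have iter (k : ℕ) : ∀ n, dyadicBase ^ n * ∫ t in (0 : ℝ)..T, Y n t ^ 3
      ≤ 2000 * E + K * 8 ^ n * (1 / 2) ^ k := by
    induction k with
    | zero =>
      intro n
      have h1 : ∫ t in (0 : ℝ)..T, Y n t ^ 3 ≤ ∫ _t in (0 : ℝ)..T, E * (E + 1) := by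
        refine intervalIntegral.integral_mono_on hT
          (Continuous.intervalIntegrable ((h.continuous n).pow 3) _ _) (by simp) fun t ht => ?_
        have h2 := h.sq_le hν hE n ht.1
        have h3 : Y n t ≤ E + 1 := by nlinarith [sq_nonneg (Y n t - 1)]
        calc Y n t ^ 3 = Y n t ^ 2 * Y n t := by ring
          _ ≤ E * (E + 1) := mul_le_mul h2 h3 (h.nonneg n t) hE0
      have h2 : ∫ _t in (0 : ℝ)..T, E * (E + 1) = K := by simp [hK]; ring
      have h3 : dyadicBase ^ n ≤ 8 ^ n :=
        pow_le_pow_left₀ hq.le (by linarith [dyadicBase_lt_six]) n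
      calc dyadicBase ^ n * ∫ t in (0 : ℝ)..T, Y n t ^ 3 ≤ 8 ^ n * K :=
            mul_le_mul h3 (h2 ▸ h1)
              (integral_nonneg_of_nonneg hT fun t => pow_nonneg (h.nonneg n t) 3) (by positivity)
        _ ≤ 2000 * E + K * 8 ^ n * (1 / 2) ^ 0 := by nlinarith
    | succ k ih =>
      intro n
      have h1 := h.cubic_moment_step hν hE n hT
      have h2 := ih (n + 1)
      have h3 := ih (n + 2)
      have e1 : K * 8 ^ (n + 1) * (1 / 2) ^ k = 8 * (K * 8 ^ n * (1 / 2) ^ k) := by ring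
      have e2 : K * 8 ^ (n + 2) * (1 / 2) ^ k = 64 * (K * 8 ^ n * (1 / 2) ^ k) := by ring
      have e3 : K * 8 ^ n * (1 / 2) ^ (k + 1) = 1 / 2 * (K * 8 ^ n * (1 / 2) ^ k) := by ring
      rw [e1] at h2
      rw [e2] at h3
      rw [e3]
      linarith
  have hlim : Tendsto (fun k : ℕ => 2000 * E + K * 8 ^ n * (1 / 2 : ℝ) ^ k) atTop
      (𝓝 (2000 * E + K * 8 ^ n * 0)) :=
    ((tendsto_pow_atTop_nhds_zero_of_lt_one (by norm_num) (by norm_num)).const_mul _).const_add _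
  rw [mul_zero, add_zero] at hlim
  exact ge_of_tendsto' hlim fun k => iter k n

/-- Quantitative comparison of a viscous and an inviscid flow with the same initial data. -/
theorem sum_difference_le {X : ℕ → ℝ → ℝ} (hY : IsDyadicFlow ν Y) (hX : IsDyadicFlow 0 X)
    (hν : 0 ≤ ν) (h0 : ∀ n, Y n 0 = X n 0)
    (hE : ∀ N, ∑ n ∈ Finset.range (N + 1), X n 0 ^ 2 ≤ E) (N : ℕ) {T : ℝ} (hT : 0 ≤ T) :
    ∑ n ∈ Finset.range (N + 1), (1 / 2) ^ n * (Y n T - X n T) ^ 2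
      ≤ ν * 2 ^ N * E * T + (1 / 2) ^ N * (32000 * E) := by
  have hcX := hX.continuous
  have hcY := hY.continuous
  have hq := dyadicBase_pos
  have hEY : ∀ N, ∑ n ∈ Finset.range (N + 1), Y n 0 ^ 2 ≤ E := by simpa only [h0] using hE
  have I (f : ℝ → ℝ) (hf : Continuous f) : IntervalIntegrable f MeasureTheory.volume 0 T :=
    hf.intervalIntegrable _ _
  have key := sub_le_integral_of_hasDerivAt_le
    (f := fun t => ∑ n ∈ Finset.range (N + 1), (1 / 2) ^ n * (Y n t - X n t) ^ 2)
    (f' := fun t => ∑ n ∈ Finset.range (N + 1), (1 / 2) ^ n * (2 * (Y n t - X n t)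
      * (dyadicField ν (fun m => Y m t) n - dyadicField 0 (fun m => X m t) n)))
    (g := fun t => ν * 2 ^ N * (∑ n ∈ Finset.range (N + 1), X n t ^ 2)
      + 4 * (1 / 2) ^ N * ((dyadicBase ^ N * Y N t ^ 3 + dyadicBase ^ N * X N t ^ 3)
        + (dyadicBase ^ (N + 1) * Y (N + 1) t ^ 3 + dyadicBase ^ (N + 1) * X (N + 1) t ^ 3)))
    hT (by fun_prop) (by fun_prop)
    (fun t ht => by
      refine HasDerivAt.fun_sum fun n _ => ?_
      simpa using (((hY.hasDerivAt n t ht).fun_sub (hX.hasDerivAt n t ht)).fun_pow 2).const_mul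
        ((1 / 2 : ℝ) ^ n))
    (fun t _ => by
      rw [sum_difference_field ν (fun m => Y m t) (fun m => X m t) (hY.zero t) (hX.zero t)]
      have hsum : -(ν * 2 ^ N * (∑ n ∈ Finset.range (N + 1), X n t ^ 2))
          ≤ ∑ n ∈ Finset.range (N + 1), (2 * ν * 2 ^ n * Y n t * (Y n t - X n t)
          + (dyadicBase / 2) ^ n * (Y n t - X n t) ^ 2 * (Y (n + 1) t + X (n + 1) t)) := by
        rw [Finset.mul_sum, ← Finset.sum_neg_distrib]
        refine Finset.sum_le_sum fun n hn => ?_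
        have h1 : 0 ≤ (dyadicBase / 2) ^ n * (Y n t - X n t) ^ 2 * (Y (n + 1) t + X (n + 1) t) :=
          mul_nonneg (by positivity) (add_nonneg (hY.nonneg _ _) (hX.nonneg _ _))
        have h2 : (2 : ℝ) ^ n ≤ 2 ^ N :=
          pow_le_pow_right₀ (by norm_num) (by simpa [Nat.lt_succ_iff] using hn)
        have h3 : ν * 2 ^ n * X n t ^ 2 ≤ ν * 2 ^ N * X n t ^ 2 := by gcongr
        have h4 : 0 ≤ ν * 2 ^ n * (Y n t ^ 2 + (Y n t - X n t) ^ 2) := by positivity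
        linarith
      have hflux : -((Y N t + X N t) * (Y N t - X N t) * (Y (N + 1) t - X (N + 1) t))
          ≤ 4 * ((Y N t ^ 3 + X N t ^ 3) + (5 * Y (N + 1) t ^ 3 + 5 * X (N + 1) t ^ 3)) := by
        have ha := hY.nonneg N t
        have hb := hX.nonneg N t
        have hc := hY.nonneg (N + 1) t
        have hd := hX.nonneg (N + 1) t
        generalize Y N t = a at *
        generalize X N t = b at *
        generalize Y (N + 1) t = c at *
        generalize X (N + 1) t = d at *
        have young (x y : ℝ) (hx : 0 ≤ x) (hy : 0 ≤ y) : x ^ 2 * y ≤ x ^ 3 + y ^ 3 := by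
          nlinarith [mul_nonneg (add_nonneg hx hy) (sq_nonneg (x - y)), pow_nonneg hx 3,
            pow_nonneg hy 3, mul_nonneg hx (sq_nonneg y)]
        have h1 := young a d ha hd
        have h2 := young b c hb hc
        have h3 : 0 ≤ a ^ 2 * c := by positivity
        have h4 : 0 ≤ b ^ 2 * d := by positivity
        have h5 := pow_nonneg ha 3
        have h6 := pow_nonneg hb 3
        have h7 := pow_nonneg hc 3
        have h8 := pow_nonneg hd 3
        linarith
      have hflux' : -((Y N t + X N t) * (Y N t - X N t) * (Y (N + 1) t - X (N + 1) t))
          ≤ 4 * ((Y N t ^ 3 + X N t ^ 3)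
            + (dyadicBase * Y (N + 1) t ^ 3 + dyadicBase * X (N + 1) t ^ 3)) := by
        have h7 := pow_nonneg (hY.nonneg (N + 1) t) 3
        have h8 := pow_nonneg (hX.nonneg (N + 1) t) 3
        nlinarith [five_lt_dyadicBase]
      have hm := mul_le_mul_of_nonneg_left hflux'
        (show 0 ≤ (1 / 2 : ℝ) ^ N * dyadicBase ^ N by positivity)
      have e1 : (dyadicBase / 2) ^ N = (1 / 2) ^ N * dyadicBase ^ N := by
        rw [← mul_pow]; ring
      have e2 : dyadicBase ^ (N + 1) = dyadicBase ^ N * dyadicBase := pow_succ _ _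
      rw [e2, e1] at *
      linarith)
  rw [intervalIntegral.integral_add (I _ (by fun_prop)) (I _ (by fun_prop)),
    intervalIntegral.integral_const_mul, intervalIntegral.integral_const_mul,
    intervalIntegral.integral_add (I _ (by fun_prop)) (I _ (by fun_prop)),
    intervalIntegral.integral_add (I _ (by fun_prop)) (I _ (by fun_prop)),
    intervalIntegral.integral_add (I _ (by fun_prop)) (I _ (by fun_prop))] at key
  simp only [intervalIntegral.integral_const_mul] at key
  have hXsum : ∫ t in (0 : ℝ)..T, ∑ n ∈ Finset.range (N + 1), X n t ^ 2 ≤ E * T := by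
    calc ∫ t in (0 : ℝ)..T, ∑ n ∈ Finset.range (N + 1), X n t ^ 2
        ≤ ∫ _t in (0 : ℝ)..T, E :=
          intervalIntegral.integral_mono_on hT (I _ (by fun_prop)) (by simp)
            fun t ht => hX.sum_sq_le le_rfl hE N ht.1
      _ = E * T := by simp [mul_comm]
  have hcubic := add_le_add
    (add_le_add (hY.cubic_moment_le hν hEY N hT) (hX.cubic_moment_le le_rfl hE N hT))
    (add_le_add (hY.cubic_moment_le hν hEY (N + 1) hT)
      (hX.cubic_moment_le le_rfl hE (N + 1) hT))
  have h1 := mul_le_mul_of_nonneg_left hXsum (show 0 ≤ ν * 2 ^ N by positivity)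
  have h2 := mul_le_mul_of_nonneg_left hcubic (show (0 : ℝ) ≤ 4 * (1 / 2) ^ N by positivity)
  simp only [h0, sub_self, ne_eq, OfNat.ofNat_ne_zero, not_false_eq_true, zero_pow, mul_zero,
    Finset.sum_const_zero, sub_zero] at key
  linarith

end IsDyadicFlow

/-- A solution of a linear equation with nonnegative source and initial value is nonnegative. -/
theorem nonneg_of_hasDerivAt_linear {f a s : ℝ → ℝ} (hf : Continuous f) (ha : Continuous a)
    (hs : ∀ t, 0 < t → 0 ≤ s t) (h0 : 0 ≤ f 0)
    (hder : ∀ t, 0 < t → HasDerivAt f (s t - a t * f t) t) {T : ℝ} (hT : 0 ≤ T) : 0 ≤ f T := by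
  set A : ℝ → ℝ := fun t => ∫ r in (0 : ℝ)..t, a r
  have hA (t : ℝ) : HasDerivAt A (a t) t := (ha.integral_hasStrictDerivAt 0 t).hasDerivAt
  have hAc : Continuous A := continuous_iff_continuousAt.2 fun t => (hA t).continuousAt
  have key := sub_le_integral_of_hasDerivAt_le (f := fun t => -(f t * Real.exp (A t)))
    (g := fun _ => 0) hT (by fun_prop) continuous_const
    (fun t ht => ((hder t ht).fun_mul (hA t).exp).fun_neg)
    (fun t ht => by
      have := mul_nonneg (hs t ht) (Real.exp_pos (A t)).le
      linarith)
  have hA0 : A 0 = 0 := intervalIntegral.integral_same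
  simp only [hA0, Real.exp_zero, mul_one, intervalIntegral.integral_zero] at key
  exact nonneg_of_mul_nonneg_left (by linarith) (Real.exp_pos (A T))

/-- The extension of a sequence of functions on `[0, ∞)` used to view it as a dyadic flow. -/
noncomputable def extendFlow (X : ℕ → ℝ → ℝ) (n : ℕ) (t : ℝ) : ℝ :=
  if n = 0 then 0 else X n (max t 0)

theorem extendFlow_of_nonneg {X : ℕ → ℝ → ℝ} {n : ℕ} (hn : 1 ≤ n) {t : ℝ} (ht : 0 ≤ t) :
    extendFlow X n t = X n t := by
  simp [extendFlow, Nat.one_le_iff_ne_zero.1 hn, max_eq_left ht]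

theorem IsViscousSolution.isDyadicFlow {ν : ℝ} {X : ℕ → ℝ → ℝ}
    (h : IsViscousSolution (5 / 2) ν (Ici 0) X) (h0 : ∀ n, 1 ≤ n → 0 ≤ X n 0) :
    IsDyadicFlow ν (extendFlow X) := by
  have hzero (t : ℝ) : extendFlow X 0 t = 0 := by simp [extendFlow]
  have hcont (n : ℕ) : Continuous (extendFlow X n) := by
    cases n with
    | zero => exact continuous_const.congr fun t => (hzero t).symm
    | succ n =>
      have hX : ContinuousOn (X (n + 1)) (Ici 0) := fun t ht =>
        (h (n + 1) (Nat.succ_pos n) t ht).continuousWithinAt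
      have : extendFlow X (n + 1) = fun t => X (n + 1) (max t 0) := by
        funext t; simp [extendFlow]
      rw [this]
      exact hX.comp_continuous (by fun_prop) fun t => le_max_right t 0
  have hder (n : ℕ) (t : ℝ) (ht : 0 < t) :
      HasDerivAt (extendFlow X n) (dyadicField ν (fun m => extendFlow X m t) n) t := by
    cases n with
    | zero =>
      have : extendFlow X 0 = fun _ => 0 := funext hzero
      rw [this]
      exact hasDerivAt_const t 0
    | succ n =>
      have h1 := (h (n + 1) (Nat.succ_pos n) t ht.le).hasDerivAt (Ici_mem_nhds ht)
      have h2 : extendFlow X (n + 1) =ᶠ[𝓝 t] X (n + 1) := by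
        filter_upwards [Ioi_mem_nhds ht] with r hr
        exact extendFlow_of_nonneg (Nat.succ_pos n) (le_of_lt hr)
      refine (h1.congr_of_eventuallyEq h2).congr_deriv ?_
      have hlam : lam (n + 1) ^ 2 = 4 ^ (n + 1) := by
        simp only [lam, Nat.succ_ne_zero, if_false]
        rw [← pow_mul, mul_comm, pow_mul]
        norm_num
      have hsource : lam n ^ (5 / 2 : ℝ) * X n t ^ 2 = dyadicBase ^ n * extendFlow X n t ^ 2 := by
        cases n with
        | zero => simp [lam, extendFlow]
        | succ m => rw [lam_succ_rpow, extendFlow_of_nonneg (Nat.succ_pos m) ht.le]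
      simp only [dyadicField, Nat.add_sub_cancel]
      rw [hlam, hsource, lam_succ_rpow, extendFlow_of_nonneg (Nat.succ_pos n) ht.le,
        extendFlow_of_nonneg (Nat.succ_pos (n + 1)) ht.le]
  have hnonneg (n : ℕ) (t : ℝ) (ht : 0 ≤ t) : 0 ≤ extendFlow X n t := by
    cases n with
    | zero => exact (hzero t).ge
    | succ n =>
      refine nonneg_of_hasDerivAt_linear (hcont (n + 1))
        (a := fun t => ν * 4 ^ (n + 1) + dyadicBase ^ (n + 1) * extendFlow X (n + 2) t)
        (s := fun t => dyadicBase ^ n * extendFlow X n t ^ 2) ?_ ?_ ?_ ?_ ht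
      · have := hcont (n + 2)
        fun_prop
      · intro t _
        have := dyadicBase_pos
        positivity
      · rw [extendFlow_of_nonneg (Nat.succ_pos n) le_rfl]
        exact h0 _ (Nat.succ_pos n)
      · intro t ht
        refine (hder (n + 1) t ht).congr_deriv ?_
        simp only [dyadicField]
        ring
  refine ⟨hcont, hzero, fun n t => ?_, hder⟩
  have : extendFlow X n t = extendFlow X n (max t 0) := by simp [extendFlow]
  rw [this]
  exact hnonneg n _ (le_max_right t 0)

theorem IsInviscidSolution.isViscousSolution {β : ℝ} {I : Set ℝ} {X : ℕ → ℝ → ℝ}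
    (h : IsInviscidSolution β I X) : IsViscousSolution β 0 I X := fun n hn t ht =>
  (h n hn t ht).congr_deriv (by ring)

theorem sq_le_of_lam_rpow_mul_le {γ C y : ℝ} (hγ : 1 / 2 < γ) {n : ℕ} (hn : 1 ≤ n) (hy : 0 ≤ y)
    (h : lam n ^ γ * y ≤ C) : y ^ 2 ≤ C ^ 2 * (1 / 2) ^ n := by
  have hlam : lam n = 2 ^ n := by simp [lam, Nat.one_le_iff_ne_zero.1 hn]
  have h1 : (1 : ℝ) ≤ 2 ^ n := one_le_pow₀ (by norm_num)
  rw [hlam] at h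
  have h2 : (2 : ℝ) ^ n ≤ (((2 : ℝ) ^ n) ^ γ) ^ 2 := by
    rw [← Real.rpow_natCast (((2 : ℝ) ^ n) ^ γ), ← Real.rpow_mul (by positivity)]
    calc (2 : ℝ) ^ n = ((2 : ℝ) ^ n) ^ (1 : ℝ) := (Real.rpow_one _).symm
      _ ≤ _ := Real.rpow_le_rpow_of_exponent_le h1 (by push_cast; linarith)
  have h3 : 2 ^ n * y ^ 2 ≤ C ^ 2 := by
    calc 2 ^ n * y ^ 2 ≤ (((2 : ℝ) ^ n) ^ γ) ^ 2 * y ^ 2 := by gcongr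
      _ = (((2 : ℝ) ^ n) ^ γ * y) ^ 2 := by ring
      _ ≤ C ^ 2 := by gcongr
  rw [one_div, inv_pow, ← div_eq_mul_inv, le_div_iff₀ (by positivity)]
  linarith

/-- for `β = 5/2`, vanishing viscosity limit. There is `γ₀ > 1/2`
such that for every `γ ∈ (1/2, γ₀)` and every nonnegative initial condition
bounded in the `λ_n^γ` scaling, the viscous solutions `X^{[ν]}` converge, as
`ν → 0⁺`, to the unique global inviscid solution bounded in the `λ_n^γ` scaling,
uniformly in time on compact sets. -/
theorem vanishing_viscosity_limit :
    ∃ γ₀ : ℝ, 1 / 2 < γ₀ ∧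
      ∀ γ : ℝ, 1 / 2 < γ → γ < γ₀ →
      ∀ x : ℕ → ℝ, (∀ n, 1 ≤ n → 0 ≤ x n) →
        (∃ C : ℝ, ∀ n, 1 ≤ n → lam n ^ γ * x n ≤ C) →
      ∀ X : ℕ → ℝ → ℝ,
        IsInviscidSolution (5 / 2) (Set.Ici 0) X →
        (∀ n, 1 ≤ n → X n 0 = x n) →
        (∃ C : ℝ, ∀ t ∈ Set.Ici (0 : ℝ), ∀ n, 1 ≤ n → lam n ^ γ * X n t ≤ C) →
      ∀ Xv : ℝ → ℕ → ℝ → ℝ,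
        (∀ ν : ℝ, 0 < ν → IsViscousSolution (5 / 2) ν (Set.Ici 0) (Xv ν) ∧
          ∀ n, 1 ≤ n → Xv ν n 0 = x n) →
      ∀ n, 1 ≤ n → ∀ T : ℝ, 0 < T →
        TendstoUniformlyOn (fun ν t => Xv ν n t) (X n)
          (nhdsWithin 0 (Set.Ioi 0)) (Set.Icc 0 T) := by
  refine ⟨1, by norm_num, ?_⟩
  rintro γ hγ - x hx ⟨C, hC⟩ X hX hX0 - Xv hXv n hn T hT
  have flowX : IsDyadicFlow 0 (extendFlow X) :=
    hX.isViscousSolution.isDyadicFlow fun m hm => (hX0 m hm).symm ▸ hx m hm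
  have flowV (ν : ℝ) (hν : 0 < ν) : IsDyadicFlow ν (extendFlow (Xv ν)) :=
    (hXv ν hν).1.isDyadicFlow fun m hm => ((hXv ν hν).2 m hm).symm ▸ hx m hm
  set E : ℝ := C ^ 2 * 2
  have hE (N : ℕ) : ∑ m ∈ Finset.range (N + 1), extendFlow X m 0 ^ 2 ≤ E := by
    calc ∑ m ∈ Finset.range (N + 1), extendFlow X m 0 ^ 2
        ≤ ∑ m ∈ Finset.range (N + 1), C ^ 2 * (1 / 2) ^ m := by
          refine Finset.sum_le_sum fun m _ => ?_
          rcases Nat.eq_zero_or_pos m with rfl | hm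
          · rw [flowX.zero, zero_pow two_ne_zero]
            positivity
          · rw [extendFlow_of_nonneg hm le_rfl, hX0 m hm]
            exact sq_le_of_lam_rpow_mul_le hγ hm (hx m hm) (hC m hm)
      _ = C ^ 2 * ∑ m ∈ Finset.range (N + 1), (1 / 2 : ℝ) ^ m := by rw [Finset.mul_sum]
      _ ≤ C ^ 2 * 2 := by
          gcongr
          exact sum_geometric_two_le (N + 1)
  rw [Metric.tendstoUniformlyOn_iff]
  intro ε hε
  have htail : Tendsto (fun N : ℕ => (1 / 2 : ℝ) ^ N * (32000 * E)) atTop (𝓝 0) := by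
    simpa using (tendsto_pow_atTop_nhds_zero_of_lt_one (r := (1 / 2 : ℝ)) (by norm_num)
      (by norm_num)).mul_const (32000 * E)
  set δ : ℝ := (1 / 2) ^ n * ε ^ 2
  have hδ : 0 < δ := by positivity
  obtain ⟨N, hN, hnN⟩ := ((htail.eventually_lt_const (half_pos hδ)).and
    (eventually_ge_atTop n)).exists
  have hvisc : Tendsto (fun ν : ℝ => ν * 2 ^ N * E * T) (𝓝[>] 0) (𝓝 0) := by
    have : Continuous fun ν : ℝ => ν * 2 ^ N * E * T := by fun_prop
    simpa using (this.tendsto 0).mono_left nhdsWithin_le_nhds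
  filter_upwards [hvisc.eventually_lt_const (half_pos hδ), self_mem_nhdsWithin] with ν hsmall hν t ht
  have hν' : 0 < ν := hν
  have hE0 : 0 ≤ E := by positivity
  have hinit (m : ℕ) : extendFlow (Xv ν) m 0 = extendFlow X m 0 := by
    rcases Nat.eq_zero_or_pos m with rfl | hm
    · rw [flowX.zero, (flowV ν hν').zero]
    · rw [extendFlow_of_nonneg hm le_rfl, extendFlow_of_nonneg hm le_rfl, hX0 m hm,
        (hXv ν hν').2 m hm]
  have hsum := (flowV ν hν').sum_difference_le flowX hν'.le hinit hE N ht.1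
  have hsingle : (1 / 2) ^ n * (extendFlow (Xv ν) n t - extendFlow X n t) ^ 2
      ≤ ∑ m ∈ Finset.range (N + 1), (1 / 2) ^ m * (extendFlow (Xv ν) m t - extendFlow X m t) ^ 2 :=
    Finset.single_le_sum
      (f := fun m => (1 / 2) ^ m * (extendFlow (Xv ν) m t - extendFlow X m t) ^ 2)
      (fun m _ => by positivity) (Finset.mem_range.2 (by omega))
  rw [extendFlow_of_nonneg hn ht.1, extendFlow_of_nonneg hn ht.1] at hsingle
  have htime : ν * 2 ^ N * E * t ≤ ν * 2 ^ N * E * T :=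
    mul_le_mul_of_nonneg_left ht.2 (by positivity)
  have hlt : (1 / 2) ^ n * (Xv ν n t - X n t) ^ 2 < (1 / 2) ^ n * ε ^ 2 := by linarith
  rw [dist_comm, Real.dist_eq]
  exact abs_lt_of_sq_lt_sq (lt_of_mul_lt_mul_left hlt (by positivity)) hε.le
end
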